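/- arXiv:1108.3476 — 2 statements merged into one kernel-verified Lean document; each statement's English description precedes it below -/
import Mathlib

section
/- If 𝓜 is finite, then for every sample x = (x₁,…,xₙ) ∈ Hⁿ, the empirical Rademacher complexity satisfies 𝓡_𝓜(x) ≤ (2^{3/2}/n) · √( Σ_{i=1}^n ‖x_i‖_{𝓜*}² ) · ( 2 + √(ln |𝓜|) ), where ‖z‖_{𝓜*} = sup_{M∈𝓜} ‖Mz‖. -/
open scoped ENNReal NNReal RealInnerProductSpace
open MeasureTheory ProbabilityTheory

/-- The infimum-convolution norm `‖β‖_𝓜` (with value `∞` outside `ℓ₁(𝓜)`). -/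
noncomputable def Mnorm {H : Type*} [NormedAddCommGroup H] [InnerProductSpace ℝ H]
    (𝓜 : Set (H →L[ℝ] H)) (β : H) : ℝ≥0∞ :=
  ⨅ v : {v : ↥𝓜 → H // HasSum (fun M : ↥𝓜 => (M : H →L[ℝ] H) (v M)) β},
    ∑' M : ↥𝓜, (‖v.1 M‖₊ : ℝ≥0∞)

/-- The empirical Rademacher complexity `𝓡_𝓜(x)`, with the expectation over the
Rademacher variables written as a uniform average over sign patterns. -/
noncomputable def radComp {H : Type*} [NormedAddCommGroup H] [InnerProductSpace ℝ H]
    (𝓜 : Set (H →L[ℝ] H)) {n : ℕ} (x : Fin n → H) : ℝ :=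
  (2 / n) * ((∑ σ : Fin n → Bool,
    sSup {r : ℝ | ∃ β : H, Mnorm 𝓜 β ≤ 1 ∧
      r = ∑ i, (if σ i then (1 : ℝ) else -1) * ⟪β, x i⟫}) / 2 ^ n)

/-- Sums of powers increase when two nonnegative numbers are spread apart with fixed sum. -/
lemma pow_add_pow_le_of_mem_Icc {P Q U V : ℝ} (hV : 0 ≤ V) (hP : P ∈ Set.Icc V U)
    (hsum : P + Q = U + V) (k : ℕ) : P ^ k + Q ^ k ≤ U ^ k + V ^ k := by
  obtain ⟨a, b, ha, hb, hab, rfl⟩ := Icc_subset_segment (𝕜 := ℝ) hP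
  have hU : 0 ≤ U := hV.trans (hP.1.trans hP.2)
  have hQ : Q = b • V + a • U := by
    simp only [smul_eq_mul] at hsum ⊢
    linear_combination hsum - (U + V) * hab
  have h₁ := (convexOn_pow k).2 (Set.mem_Ici.2 hV) (Set.mem_Ici.2 hU) ha hb hab
  have h₂ := (convexOn_pow k).2 (Set.mem_Ici.2 hV) (Set.mem_Ici.2 hU) hb ha (add_comm a b ▸ hab)
  rw [hQ]
  simp only [smul_eq_mul] at h₁ h₂ ⊢
  have h₃ : a * V ^ k + b * U ^ k + (b * V ^ k + a * U ^ k) = U ^ k + V ^ k := by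
    linear_combination (U ^ k + V ^ k) * hab
  linarith

/-- Two-point inequality for `cosh ‖·‖` in an inner product space. -/
lemma cosh_norm_add_add_cosh_norm_sub_le {H : Type*} [NormedAddCommGroup H]
    [InnerProductSpace ℝ H] (x y : H) :
    Real.cosh ‖x + y‖ + Real.cosh ‖x - y‖ ≤ 2 * (Real.cosh ‖x‖ * Real.cosh ‖y‖) := by
  have hprod : 2 * (Real.cosh ‖x‖ * Real.cosh ‖y‖) =
      Real.cosh (‖x‖ + ‖y‖) + Real.cosh (‖x‖ - ‖y‖) := by
    rw [Real.cosh_add, Real.cosh_sub]; ring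
  rw [hprod]
  refine hasSum_le (fun k => ?_)
    ((Real.hasSum_cosh ‖x + y‖).add (Real.hasSum_cosh ‖x - y‖))
    ((Real.hasSum_cosh (‖x‖ + ‖y‖)).add (Real.hasSum_cosh (‖x‖ - ‖y‖)))
  simp only [← add_div, pow_mul]
  have hadd := norm_add_sq_real x y
  have hsub := norm_sub_sq_real x y
  have hcs := abs_le.1 (abs_real_inner_le_norm x y)
  refine div_le_div_of_nonneg_right ?_ (by positivity)
  refine pow_add_pow_le_of_mem_Icc (sq_nonneg _) ⟨?_, ?_⟩ ?_ k <;> nlinarith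

/-- The exponential moment bound for Rademacher sums in an inner product space. -/
lemma sum_cosh_norm_rademacher_le {H : Type*} [NormedAddCommGroup H] [InnerProductSpace ℝ H] :
    ∀ {n : ℕ} (w : Fin n → H) (y : H),
      ∑ σ : Fin n → Bool, Real.cosh ‖y + ∑ i, (if σ i then (1 : ℝ) else -1) • w i‖ ≤
        2 ^ n * (Real.cosh ‖y‖ * ∏ i, Real.cosh ‖w i‖)
  | 0, w, y => by simp
  | n + 1, w, y => by
    rw [← (Fin.consEquiv fun _ : Fin (n + 1) => Bool).sum_comp, Fintype.sum_prod_type]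
    simp only [Fin.consEquiv_apply, Fin.sum_univ_succ, Fin.cons_zero, Fin.cons_succ,
      Fintype.sum_bool, ← add_assoc, Fin.prod_univ_succ]
    have h₁ := sum_cosh_norm_rademacher_le (fun i => w i.succ) (y + w 0)
    have h₂ := sum_cosh_norm_rademacher_le (fun i => w i.succ) (y - w 0)
    have h₃ := mul_le_mul_of_nonneg_left (cosh_norm_add_add_cosh_norm_sub_le y (w 0))
      (mul_nonneg (by positivity : (0 : ℝ) ≤ 2 ^ n)
        (Finset.prod_nonneg fun i (_ : i ∈ Finset.univ) => (Real.cosh_pos ‖w (Fin.succ i)‖).le))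
    simp only [if_true, Bool.false_eq_true, if_false, one_smul, neg_smul, ← sub_eq_add_neg]
    refine (add_le_add h₁ h₂).trans ?_
    rw [pow_succ]
    linarith

/-- Duality between `Mnorm` and the norm `sup ‖M z‖`. -/
lemma inner_le_of_Mnorm_le_one {H : Type*} [NormedAddCommGroup H] [InnerProductSpace ℝ H]
    {𝓜 : Set (H →L[ℝ] H)} [Fintype ↥𝓜]
    (hsym : ∀ M ∈ 𝓜, ∀ x y : H, ⟪M x, y⟫ = ⟪x, M y⟫)
    {β z : H} (hβ : Mnorm 𝓜 β ≤ 1) {D : ℝ} (hD : 0 ≤ D)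
    (hz : ∀ M ∈ 𝓜, ‖M z‖ ≤ D) : ⟪β, z⟫ ≤ D := by
  have key : ∀ r : ℝ, 1 < r → ⟪β, z⟫ ≤ r * D := by
    intro r hr
    have hlt : Mnorm 𝓜 β < ENNReal.ofReal r :=
      hβ.trans_lt (by simpa using hr)
    obtain ⟨⟨v, hv⟩, hvr⟩ := iInf_lt_iff.1 hlt
    rw [tsum_fintype, ← ENNReal.ofNNReal_finsetSum, ENNReal.ofReal, ENNReal.coe_lt_coe,
      ← NNReal.coe_lt_coe, Real.coe_toNNReal r (by linarith)] at hvr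
    push_cast at hvr
    rw [hv.unique (hasSum_fintype _), sum_inner]
    calc ∑ M : ↥𝓜, ⟪(M : H →L[ℝ] H) (v M), z⟫ ≤ ∑ M : ↥𝓜, ‖v M‖ * D := by
          refine Finset.sum_le_sum fun M _ => ?_
          rw [hsym M M.2]
          exact (real_inner_le_norm _ _).trans
            (mul_le_mul_of_nonneg_left (hz M M.2) (norm_nonneg _))
      _ = (∑ M : ↥𝓜, ‖v M‖) * D := by rw [Finset.sum_mul]
      _ ≤ r * D := mul_le_mul_of_nonneg_right hvr.le hD
  refine le_of_forall_pos_le_add fun ε hε => ?_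
  have h := key (1 + ε / (D + 1)) (by linarith [show 0 < ε / (D + 1) by positivity])
  have h' : ε / (D + 1) * D ≤ ε := by
    rw [div_mul_eq_mul_div, div_le_iff₀ (by linarith)]
    nlinarith
  linarith

/-- The norm of a Rademacher sum satisfies a sub-Gaussian exponential moment bound. -/
lemma sum_exp_norm_rademacher_le {H : Type*} [NormedAddCommGroup H] [InnerProductSpace ℝ H]
    {n : ℕ} (w : Fin n → H) {t : ℝ} (ht : 0 ≤ t) :
    ∑ σ : Fin n → Bool, Real.exp (t * ‖∑ i, (if σ i then (1 : ℝ) else -1) • w i‖) ≤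
      2 ^ n * (2 * Real.exp (t ^ 2 * (∑ i, ‖w i‖ ^ 2) / 2)) := by
  have h := sum_cosh_norm_rademacher_le (fun i => t • w i) 0
  have hnorm : ∀ σ : Fin n → Bool, ‖(0 : H) + ∑ i, (if σ i then (1 : ℝ) else -1) • t • w i‖ =
      t * ‖∑ i, (if σ i then (1 : ℝ) else -1) • w i‖ := fun σ => by
    simp_rw [zero_add, smul_comm _ t, ← Finset.smul_sum, norm_smul, Real.norm_of_nonneg ht]
  simp only [hnorm, norm_zero, Real.cosh_zero, one_mul] at h
  have hprod : ∏ i, Real.cosh ‖t • w i‖ ≤ Real.exp (t ^ 2 * (∑ i, ‖w i‖ ^ 2) / 2) := by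
    rw [Finset.mul_sum, Finset.sum_div, Real.exp_sum]
    refine Finset.prod_le_prod (fun i _ => (Real.cosh_pos _).le) fun i _ => ?_
    refine (Real.cosh_le_exp_half_sq _).trans_eq ?_
    rw [norm_smul, Real.norm_of_nonneg ht, mul_pow]
  calc _ ≤ ∑ σ : Fin n → Bool,
        2 * Real.cosh (t * ‖∑ i, (if σ i then (1 : ℝ) else -1) • w i‖) := by
        refine Finset.sum_le_sum fun σ _ => ?_
        rw [Real.cosh_eq]
        linarith [Real.exp_pos (-(t * ‖∑ i, (if σ i then (1 : ℝ) else -1) • w i‖))]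
    _ ≤ 2 * (2 ^ n * ∏ i, Real.cosh ‖t • w i‖) := by
        rw [← Finset.mul_sum]; linarith
    _ ≤ _ := by
        have := mul_le_mul_of_nonneg_left hprod (by positivity : (0 : ℝ) ≤ 2 ^ n)
        linarith

/-- Maximal inequality for finitely many Rademacher sums in an inner product space. -/
lemma average_iSup_norm_rademacher_le {H ι : Type*} [NormedAddCommGroup H]
    [InnerProductSpace ℝ H] [Fintype ι] [Nonempty ι] {n : ℕ} (w : ι → Fin n → H) {B : ℝ}
    (hB : 0 ≤ B) (hw : ∀ j, ∑ i, ‖w j i‖ ^ 2 ≤ B ^ 2) :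
    (∑ σ : Fin n → Bool, ⨆ j, ‖∑ i, (if σ i then (1 : ℝ) else -1) • w j i‖) / 2 ^ n ≤
      B * √(2 * Real.log (2 * Fintype.card ι)) := by
  set Y : (Fin n → Bool) → ℝ := fun σ => ⨆ j, ‖∑ i, (if σ i then (1 : ℝ) else -1) • w j i‖
  set L := Real.log (2 * Fintype.card ι)
  set E := (∑ σ, Y σ) / 2 ^ n with hE
  have hcard : (1 : ℝ) ≤ Fintype.card ι := by exact_mod_cast Fintype.card_pos (α := ι)
  have hL : 0 < L := Real.log_pos (by linarith)
  have hexpL : Real.exp L = 2 * Fintype.card ι := Real.exp_log (by linarith)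
  have key : ∀ t : ℝ, 0 < t → t * E ≤ L + t ^ 2 * B ^ 2 / 2 := by
    intro t ht
    set c := L + t ^ 2 * B ^ 2 / 2 with hc
    have hsum : ∑ σ, Real.exp (t * Y σ) ≤ 2 ^ n * Real.exp c := by
      calc ∑ σ, Real.exp (t * Y σ) ≤ ∑ σ : Fin n → Bool, ∑ j,
            Real.exp (t * ‖∑ i, (if σ i then (1 : ℝ) else -1) • w j i‖) := by
            refine Finset.sum_le_sum fun σ _ => ?_
            obtain ⟨j, hj⟩ := exists_eq_ciSup_of_finite
              (f := fun j => ‖∑ i, (if σ i then (1 : ℝ) else -1) • w j i‖)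
            simp only [Y, ← hj]
            exact Finset.single_le_sum
              (f := fun j => Real.exp (t * ‖∑ i, (if σ i then (1 : ℝ) else -1) • w j i‖))
              (fun _ _ => (Real.exp_pos _).le) (Finset.mem_univ j)
        _ ≤ ∑ _j : ι, 2 ^ n * (2 * Real.exp (t ^ 2 * B ^ 2 / 2)) := by
            rw [Finset.sum_comm]
            refine Finset.sum_le_sum fun j _ => (sum_exp_norm_rademacher_le (w j) ht.le).trans ?_
            gcongr
            exact hw j
        _ = 2 ^ n * Real.exp c := by
            rw [hc, Real.exp_add, hexpL]
            simp only [Finset.sum_const, Finset.card_univ, nsmul_eq_mul]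
            ring
    have htangent : ∀ σ, t * Y σ ≤ c - 1 + Real.exp (t * Y σ) * Real.exp (-c) := fun σ => by
      rw [← Real.exp_add]
      linarith [Real.add_one_le_exp (t * Y σ + -c)]
    have hle : t * ∑ σ, Y σ ≤ 2 ^ n * c := by
      calc t * ∑ σ, Y σ ≤ ∑ σ, (c - 1 + Real.exp (t * Y σ) * Real.exp (-c)) := by
            rw [Finset.mul_sum]; exact Finset.sum_le_sum fun σ _ => htangent σ
        _ = 2 ^ n * (c - 1) + (∑ σ, Real.exp (t * Y σ)) * Real.exp (-c) := by
            rw [Finset.sum_add_distrib, Finset.sum_mul]; simp [mul_sub]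
        _ ≤ 2 ^ n * (c - 1) + 2 ^ n * Real.exp c * Real.exp (-c) := by gcongr
        _ = 2 ^ n * c := by
            rw [mul_assoc, ← Real.exp_add, add_neg_cancel, Real.exp_zero]; ring
    rw [hE, ← mul_div_assoc, div_le_iff₀ (by positivity)]
    linarith
  rcases le_or_gt E 0 with hE0 | hE0
  · exact hE0.trans (by positivity)
  have h := key (2 * L / E) (by positivity)
  have hsq : E ^ 2 ≤ B ^ 2 * (2 * L) := by
    rw [div_mul_cancel₀ _ hE0.ne', div_pow] at h
    have h' : L ≤ (2 * L) ^ 2 * B ^ 2 / 2 / E ^ 2 := by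
      calc L ≤ (2 * L) ^ 2 / E ^ 2 * B ^ 2 / 2 := by linarith
        _ = _ := by ring
    rw [le_div_iff₀ (by positivity)] at h'
    nlinarith
  refine (Real.le_sqrt_of_sq_le hsq).trans_eq ?_
  rw [Real.sqrt_mul (sq_nonneg B), Real.sqrt_sq hB]

/-- Theorem 2 (main theorem), second inequality: for finite `𝓜`,
`𝓡_𝓜(x) ≤ (2^{3/2}/n) √(Σ_i ‖x_i‖_{𝓜*}²) (2 + √(ln |𝓜|))`,
where `‖z‖_{𝓜*} = sup_{M ∈ 𝓜} ‖M z‖`. -/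
theorem rademacher_main_bound_finite
    {H : Type*} [NormedAddCommGroup H] [InnerProductSpace ℝ H] [CompleteSpace H]
    (𝓜 : Set (H →L[ℝ] H)) (hfin : 𝓜.Finite)
    (hsym : ∀ M ∈ 𝓜, ∀ x y : H, ⟪M x, y⟫ = ⟪x, M y⟫)
    (hnondeg : ∀ x : H, x ≠ 0 → ∃ M ∈ 𝓜, M x ≠ 0)
    (C₀ : ℝ) (hbdd : ∀ M ∈ 𝓜, ‖M‖ ≤ C₀)
    {n : ℕ} (hn : 0 < n) (x : Fin n → H) :
    radComp 𝓜 x ≤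
      (2 ^ ((3 : ℝ) / 2) / n) *
        Real.sqrt (∑ i, (⨆ M : ↥𝓜, ‖(M : H →L[ℝ] H) (x i)‖) ^ 2) *
        (2 + Real.sqrt (Real.log (Nat.card ↥𝓜))) := by
  have := hfin.fintype
  set D : Fin n → ℝ := fun i => ⨆ M : ↥𝓜, ‖(M : H →L[ℝ] H) (x i)‖
  set B := √(∑ i, D i ^ 2)
  set Z : (Fin n → Bool) → H := fun σ => ∑ i, (if σ i then (1 : ℝ) else -1) • x i
  have hsup : ∀ σ : Fin n → Bool, sSup {r : ℝ | ∃ β : H, Mnorm 𝓜 β ≤ 1 ∧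
      r = ∑ i, (if σ i then (1 : ℝ) else -1) * ⟪β, x i⟫} ≤
      ⨆ M : ↥𝓜, ‖(M : H →L[ℝ] H) (Z σ)‖ := by
    intro σ
    have h0 : 0 ≤ ⨆ M : ↥𝓜, ‖(M : H →L[ℝ] H) (Z σ)‖ := Real.iSup_nonneg fun _ => norm_nonneg _
    refine Real.sSup_le ?_ h0
    rintro r ⟨β, hβ, rfl⟩
    have hr : ∑ i, (if σ i then (1 : ℝ) else -1) * ⟪β, x i⟫ = ⟪β, Z σ⟫ := by
      simp only [Z, inner_sum, real_inner_smul_right]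
    rw [hr]
    exact inner_le_of_Mnorm_le_one hsym hβ h0 fun M hM =>
      le_ciSup (f := fun M : ↥𝓜 => ‖(M : H →L[ℝ] H) (Z σ)‖) (Set.finite_range _).bddAbove ⟨M, hM⟩
  have havg : (∑ σ : Fin n → Bool, ⨆ M : ↥𝓜, ‖(M : H →L[ℝ] H) (Z σ)‖) / 2 ^ n ≤
      √2 * B * (2 + √(Real.log (Nat.card ↥𝓜))) := by
    rcases isEmpty_or_nonempty ↥𝓜 with hempty | hne
    · simp only [Real.iSup_of_isEmpty, Finset.sum_const_zero, zero_div]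
      positivity
    have hw : ∀ M : ↥𝓜, ∑ i, ‖(M : H →L[ℝ] H) (x i)‖ ^ 2 ≤ B ^ 2 := by
      intro M
      rw [Real.sq_sqrt (by positivity)]
      gcongr with i
      exact le_ciSup (f := fun M : ↥𝓜 => ‖(M : H →L[ℝ] H) (x i)‖) (Set.finite_range _).bddAbove M
    have h := average_iSup_norm_rademacher_le
      (fun (M : ↥𝓜) i => (M : H →L[ℝ] H) (x i)) (Real.sqrt_nonneg _) hw
    simp only [← map_smul, ← map_sum] at h
    refine h.trans ?_
    have hcard : (1 : ℝ) ≤ Fintype.card ↥𝓜 := by exact_mod_cast Fintype.card_pos (α := ↥𝓜)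
    have hlog : 0 ≤ Real.log (Fintype.card ↥𝓜) := Real.log_nonneg hcard
    have hroot : √(Real.log (2 * Fintype.card ↥𝓜)) ≤ 2 + √(Real.log (Fintype.card ↥𝓜)) := by
      rw [Real.log_mul two_ne_zero (by linarith)]
      refine Real.sqrt_le_iff.2 ⟨by positivity, ?_⟩
      nlinarith [Real.sq_sqrt hlog, Real.sqrt_nonneg (Real.log (Fintype.card ↥𝓜)),
        Real.log_two_lt_d9]
    rw [Real.sqrt_mul zero_le_two, Nat.card_eq_fintype_card]
    calc B * (√2 * √(Real.log (2 * Fintype.card ↥𝓜)))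
        = √2 * B * √(Real.log (2 * Fintype.card ↥𝓜)) := by ring
      _ ≤ _ := by gcongr
  have hpow : (2 : ℝ) ^ ((3 : ℝ) / 2) = 2 * √2 := by
    rw [Real.sqrt_eq_rpow, ← Real.rpow_one_add' (by norm_num) (by norm_num)]
    norm_num
  calc radComp 𝓜 x
      ≤ (2 / n) * ((∑ σ : Fin n → Bool, ⨆ M : ↥𝓜, ‖(M : H →L[ℝ] H) (Z σ)‖) / 2 ^ n) := by
        unfold radComp
        gcongr with σ
        exact hsup σ
    _ ≤ (2 / n) * (√2 * B * (2 + √(Real.log (Nat.card ↥𝓜)))) := by gcongr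
    _ = _ := by rw [hpow]; ring
end

section
/- Let 1 < q ≤ 2 and let p be the conjugate exponent of q (1/q + 1/p = 1). For every sample x = (x₁,…,xₙ) ∈ Hⁿ, the empirical Rademacher complexity 𝓡_{𝓜_q}(x) of the class of linear functions parameterized by β with ‖β‖_{𝓜_q} ≤ 1 satisfies 𝓡_{𝓜_q}(x) ≤ (2^{3/2}/n) · √( π p Σ_{i=1}^n ‖x_i‖²_{𝓜_q*} ), where ‖z‖_{𝓜_q*} = ( Σ_{M∈𝓜} ‖Mz‖^p )^{1/p}. -/
open scoped ENNReal NNReal RealInnerProductSpace Real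
open MeasureTheory

/-- The infimum-convolution `ℓ_q` norm `‖β‖_{𝓜_q}` (with value `∞` outside its
finiteness domain). -/
noncomputable def MnormQ {H : Type*} [NormedAddCommGroup H] [InnerProductSpace ℝ H]
    (𝓜 : Set (H →L[ℝ] H)) (q : ℝ) (β : H) : ℝ≥0∞ :=
  ⨅ v : {v : ↥𝓜 → H // HasSum (fun M : ↥𝓜 => (M : H →L[ℝ] H) (v M)) β},
    (∑' M : ↥𝓜, (‖v.1 M‖₊ : ℝ≥0∞) ^ q) ^ (1 / q)

/-- The empirical Rademacher complexity `𝓡_{𝓜_q}(x)` of the class of linear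
functions with `‖β‖_{𝓜_q} ≤ 1`, the expectation over the Rademacher variables
written as a uniform average over sign patterns. -/
noncomputable def radCompQ {H : Type*} [NormedAddCommGroup H] [InnerProductSpace ℝ H]
    (𝓜 : Set (H →L[ℝ] H)) (q : ℝ) {n : ℕ} (x : Fin n → H) : ℝ :=
  (2 / n) * ((∑ σ : Fin n → Bool,
    sSup {r : ℝ | ∃ β : H, MnormQ 𝓜 q β ≤ 1 ∧
      r = ∑ i, (if σ i then (1 : ℝ) else -1) * ⟪β, x i⟫}) / 2 ^ n)

theorem Real.pow_add_pow_sub_le_of_abs_le {A s t : ℝ} (hs : s ≤ A) (ht : |t| ≤ s) (k : ℕ) :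
    (A + t) ^ k + (A - t) ^ k ≤ (A + s) ^ k + (A - s) ^ k := by
  obtain ⟨h1, h2⟩ := abs_le.1 ht
  rcases (abs_nonneg t |>.trans ht).eq_or_lt with h0 | h0
  · have : t = 0 := by linarith
    simp [this, ← h0]
  have hc := (convexOn_pow (𝕜 := ℝ) k).2 (x := A + s) (y := A - s) (by simp; linarith)
    (by simp; linarith)
  have e1 := hc (a := (s + t) / (2 * s)) (b := (s - t) / (2 * s)) (by apply div_nonneg <;> linarith)
    (by apply div_nonneg <;> linarith) (by field_simp; ring)
  have e2 := hc (a := (s - t) / (2 * s)) (b := (s + t) / (2 * s)) (by apply div_nonneg <;> linarith)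
    (by apply div_nonneg <;> linarith) (by field_simp; ring)
  simp only [smul_eq_mul] at e1 e2
  have a1 : (s + t) / (2 * s) * (A + s) + (s - t) / (2 * s) * (A - s) = A + t := by
    field_simp; ring
  have a2 : (s - t) / (2 * s) * (A + s) + (s + t) / (2 * s) * (A - s) = A - t := by
    field_simp; ring
  rw [a1] at e1
  rw [a2] at e2
  have a3 : (s + t) / (2 * s) = 1 - (s - t) / (2 * s) := by field_simp; ring
  rw [a3] at e1 e2
  linarith

section Khintchine

variable {H : Type*} [NormedAddCommGroup H] [InnerProductSpace ℝ H]

theorem cosh_norm_add_add_cosh_norm_sub_le_s15 (a b : H) :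
    Real.cosh ‖a + b‖ + Real.cosh ‖a - b‖ ≤ 2 * (Real.cosh ‖a‖ * Real.cosh ‖b‖) := by
  have h2 : 2 * (Real.cosh ‖a‖ * Real.cosh ‖b‖) =
      Real.cosh (‖a‖ + ‖b‖) + Real.cosh (‖a‖ - ‖b‖) := by
    rw [Real.cosh_add, Real.cosh_sub]; ring
  rw [h2]
  refine hasSum_le (fun k => ?_) ((Real.hasSum_cosh _).add (Real.hasSum_cosh _))
    ((Real.hasSum_cosh _).add (Real.hasSum_cosh _))
  simp only [← add_div, pow_mul]
  refine div_le_div_of_nonneg_right ?_ (Nat.cast_nonneg _)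
  have hab : |2 * ⟪a, b⟫| ≤ 2 * (‖a‖ * ‖b‖) := by
    rw [abs_mul, abs_two]
    gcongr
    exact abs_real_inner_le_norm a b
  have := Real.pow_add_pow_sub_le_of_abs_le (A := ‖a‖ ^ 2 + ‖b‖ ^ 2)
    (by nlinarith [sq_nonneg (‖a‖ - ‖b‖)]) hab k
  rw [norm_add_sq_real, norm_sub_sq_real, add_sq, sub_sq]
  simpa only [add_right_comm, sub_add_eq_add_sub, mul_assoc] using this

theorem sum_cosh_norm_add_signed_sum_le {n : ℕ} (a : H) (y : Fin n → H) :
    ∑ σ : Fin n → Bool, Real.cosh ‖a + ∑ i, (if σ i then (1 : ℝ) else -1) • y i‖ ≤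
      2 ^ n * (Real.cosh ‖a‖ * ∏ i, Real.cosh ‖y i‖) := by
  induction n generalizing a with
  | zero => simp
  | succ n ih =>
    rw [← (Fin.consEquiv fun _ => Bool).sum_comp, Fintype.sum_prod_type]
    simp only [Fin.consEquiv_apply, Fin.sum_univ_succ, Fin.cons_zero, Fin.cons_succ,
      Fin.prod_univ_succ, Fintype.sum_bool, ← add_assoc]
    have h1 := ih (a + y 0) (fun i => y i.succ)
    have h2 := ih (a - y 0) (fun i => y i.succ)
    have hP : 0 ≤ 2 ^ n * ∏ i : Fin n, Real.cosh ‖y i.succ‖ := by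
      have : ∀ i : Fin n, 0 ≤ Real.cosh ‖y i.succ‖ := fun i => (Real.cosh_pos _).le
      positivity [Finset.prod_nonneg fun i (_ : i ∈ Finset.univ) => this i]
    have h3 := mul_le_mul_of_nonneg_left (cosh_norm_add_add_cosh_norm_sub_le_s15 a (y 0)) hP
    simp only [if_true, one_smul, Bool.false_eq_true, if_false, neg_smul, ← sub_eq_add_neg]
    rw [pow_succ]
    linarith

/-- A Khintchine inequality in Hilbert space. -/
theorem sum_norm_signed_sum_rpow_le {n : ℕ} (y : Fin n → H) {p : ℝ} (hp : 2 ≤ p) :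
    ∑ σ : Fin n → Bool, ‖∑ i, (if σ i then (1 : ℝ) else -1) • y i‖ ^ p ≤
      2 ^ n * (p * ∑ i, ‖y i‖ ^ 2) ^ (p / 2) := by
  have hp0 : 0 < p := by linarith
  set s := ∑ i, ‖y i‖ ^ 2 with hs
  have hs0 : 0 ≤ s := by positivity
  rcases hs0.eq_or_lt with h0 | h0
  · have hy : ∀ i, y i = 0 := by
      intro i
      have := (Finset.sum_eq_zero_iff_of_nonneg (fun i _ => by positivity)).1 h0.symm i
        (Finset.mem_univ i)
      simpa using this
    simp only [hy, smul_zero, Finset.sum_const_zero, norm_zero]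
    simp only [Real.zero_rpow hp0.ne', Finset.sum_const_zero]
    positivity
  set c := √(p / s) with hc
  have hc0 : 0 < c := by positivity
  have hcs : c ^ 2 * s = p := by
    rw [hc, Real.sq_sqrt (by positivity)]; field_simp
  have hcosh : ∑ σ : Fin n → Bool,
      Real.cosh (c * ‖∑ i, (if σ i then (1 : ℝ) else -1) • y i‖) ≤ 2 ^ n * Real.exp (p / 2) := by
    have h := sum_cosh_norm_add_signed_sum_le 0 (fun i => c • y i)
    have e : ∀ σ : Fin n → Bool, ‖0 + ∑ i, (if σ i then (1 : ℝ) else -1) • c • y i‖ =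
        c * ‖∑ i, (if σ i then (1 : ℝ) else -1) • y i‖ := by
      intro σ
      simp_rw [smul_comm _ c]
      rw [zero_add, ← Finset.smul_sum, norm_smul, Real.norm_of_nonneg hc0.le]
    simp only [e, norm_zero, Real.cosh_zero, one_mul] at h
    refine h.trans ?_
    gcongr
    calc ∏ i, Real.cosh ‖c • y i‖ ≤ ∏ i, Real.exp (‖c • y i‖ ^ 2 / 2) :=
          Finset.prod_le_prod (fun i _ => (Real.cosh_pos _).le)
            fun i _ => Real.cosh_le_exp_half_sq _
      _ = Real.exp (p / 2) := by
          rw [← Real.exp_sum, ← Finset.sum_div]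
          simp_rw [norm_smul, mul_pow]
          rw [← Finset.mul_sum, Real.norm_of_nonneg hc0.le, hcs]
  have hpt : ∀ u : ℝ, 0 ≤ u → u ^ p ≤ (p / c) ^ p * Real.exp (-p) * 2 * Real.cosh (c * u) := by
    intro u hu
    have h1 : c * u / p ≤ Real.exp (c * u / p - 1) := by
      linarith [Real.add_one_le_exp (c * u / p - 1)]
    have h2 := Real.rpow_le_rpow (by positivity) h1 hp0.le
    rw [← Real.exp_mul] at h2
    have h3 : (c * u / p - 1) * p = c * u + -p := by field_simp; ring
    rw [h3, Real.exp_add] at h2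
    have h4 : Real.exp (c * u) ≤ 2 * Real.cosh (c * u) := by
      rw [Real.cosh_eq]; linarith [Real.exp_pos (-(c * u))]
    have h5 : u ^ p = (p / c) ^ p * (c * u / p) ^ p := by
      rw [← Real.mul_rpow (by positivity) (by positivity)]
      congr 1; field_simp
    rw [h5]
    calc (p / c) ^ p * (c * u / p) ^ p ≤ (p / c) ^ p * (2 * Real.cosh (c * u) * Real.exp (-p)) := by
          gcongr
          exact h2.trans (by gcongr)
      _ = _ := by ring
  have hK : (p / c) ^ p = (p * s) ^ (p / 2) := by
    have : p * s = (p / c) ^ (2 : ℝ) := by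
      rw [Real.rpow_two, div_pow, eq_div_iff (by positivity), ← hcs]; ring
    rw [this, ← Real.rpow_mul (by positivity)]
    congr 1; ring
  have he : Real.exp (-p) * 2 * Real.exp (p / 2) ≤ 1 := by
    have h2 : (2 : ℝ) ≤ Real.exp (p / 2) := by linarith [Real.add_one_le_exp (p / 2)]
    calc Real.exp (-p) * 2 * Real.exp (p / 2)
        ≤ Real.exp (-p) * Real.exp (p / 2) * Real.exp (p / 2) := by gcongr
      _ = 1 := by
        rw [← Real.exp_add, ← Real.exp_add, ← Real.exp_zero]; congr 1; ring
  calc _ ≤ ∑ σ : Fin n → Bool, (p / c) ^ p * Real.exp (-p) * 2 *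
        Real.cosh (c * ‖∑ i, (if σ i then (1 : ℝ) else -1) • y i‖) :=
        Finset.sum_le_sum fun σ _ => hpt _ (norm_nonneg _)
    _ ≤ (p / c) ^ p * Real.exp (-p) * 2 * (2 ^ n * Real.exp (p / 2)) := by
        rw [← Finset.mul_sum]; gcongr
    _ = 2 ^ n * (p * s) ^ (p / 2) * (Real.exp (-p) * 2 * Real.exp (p / 2)) := by rw [hK]; ring
    _ ≤ 2 ^ n * (p * s) ^ (p / 2) * 1 := by gcongr
    _ = _ := mul_one _

end Khintchine

/-- Minkowski's inequality for finitely many nonnegative functions. -/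
theorem Real.Lp_finset_sum_le_tsum_of_nonneg {ι κ : Type*} (s : Finset κ) {r : ℝ} (hr : 1 ≤ r)
    {f : κ → ι → ℝ} (hf : ∀ i j, 0 ≤ f i j) (hsum : ∀ i, Summable fun j => f i j ^ r) :
    (Summable fun j => (∑ i ∈ s, f i j) ^ r) ∧
      (∑' j, (∑ i ∈ s, f i j) ^ r) ^ (1 / r) ≤ ∑ i ∈ s, (∑' j, f i j ^ r) ^ (1 / r) := by
  classical
  have hr0 : r ≠ 0 := by linarith
  induction s using Finset.induction_on with
  | empty => simp [Real.zero_rpow hr0, Real.zero_rpow (inv_ne_zero hr0)]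
  | insert a s ha ih =>
    simp only [Finset.sum_insert ha]
    obtain ⟨h1, h2⟩ := Real.Lp_add_le_tsum_of_nonneg hr (hf a)
      (fun j => Finset.sum_nonneg fun i _ => hf i j) (hsum a) ih.1
    exact ⟨h1, h2.trans (by gcongr; exact ih.2)⟩

section Duality

variable {H : Type*} [NormedAddCommGroup H] [InnerProductSpace ℝ H]

theorem inner_le_of_MnormQ_le_one {𝓜 : Set (H →L[ℝ] H)}
    (hsym : ∀ M ∈ 𝓜, ∀ x y : H, ⟪M x, y⟫ = ⟪x, M y⟫) {q p : ℝ} (hqp : q.HolderConjugate p)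
    {β z : H} (hβ : MnormQ 𝓜 q β ≤ 1)
    (hz : Summable fun M : ↥𝓜 => ‖(M : H →L[ℝ] H) z‖ ^ p) :
    ⟪β, z⟫ ≤ (∑' M : ↥𝓜, ‖(M : H →L[ℝ] H) z‖ ^ p) ^ (1 / p) := by
  have hq0 : 0 < q := hqp.pos
  set N := (∑' M : ↥𝓜, ‖(M : H →L[ℝ] H) z‖ ^ p) ^ (1 / p) with hN
  have hN0 : 0 ≤ N := by positivity
  have key : ∀ t : ℝ≥0, 1 < t → ⟪β, z⟫ ≤ t * N := by
    intro t ht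
    have hlt : MnormQ 𝓜 q β < t := hβ.trans_lt (by exact_mod_cast ht)
    obtain ⟨⟨v, hv⟩, hvt⟩ := iInf_lt_iff.1 hlt
    have hvt' : ∑' M : ↥𝓜, (‖v M‖₊ : ℝ≥0∞) ^ q ≤ (t : ℝ≥0∞) ^ q := by
      have := ENNReal.rpow_le_rpow hvt.le hq0.le
      rwa [← ENNReal.rpow_mul, one_div_mul_cancel hq0.ne', ENNReal.rpow_one] at this
    simp only [← ENNReal.coe_rpow_of_nonneg _ hq0.le] at hvt'
    have hsn : Summable fun M : ↥𝓜 => ‖v M‖₊ ^ q :=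
      ENNReal.tsum_coe_ne_top_iff_summable.1 (hvt'.trans_lt ENNReal.coe_lt_top).ne
    have hs : Summable fun M : ↥𝓜 => ‖v M‖ ^ q := by
      have := NNReal.summable_coe.2 hsn
      simpa using this
    have hle : ∑' M : ↥𝓜, ‖v M‖ ^ q ≤ (t : ℝ) ^ q := by
      rw [← ENNReal.coe_tsum hsn, ENNReal.coe_le_coe] at hvt'
      have := NNReal.coe_le_coe.2 hvt'
      rw [NNReal.coe_tsum] at this
      simpa using this
    obtain ⟨hS, hH⟩ := Real.summable_and_inner_le_Lp_mul_Lq_tsum_of_nonneg hqp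
      (fun M : ↥𝓜 => norm_nonneg (v M)) (fun M : ↥𝓜 => norm_nonneg ((M : H →L[ℝ] H) z)) hs hz
    have hin : HasSum (fun M : ↥𝓜 => ⟪(M : H →L[ℝ] H) (v M), z⟫) ⟪β, z⟫ := by
      have := hv.mapL (innerSL ℝ z)
      simpa [real_inner_comm] using this
    calc ⟪β, z⟫ ≤ ∑' M : ↥𝓜, ‖v M‖ * ‖(M : H →L[ℝ] H) z‖ :=
          hasSum_le (fun M => by rw [hsym M M.2]; exact real_inner_le_norm _ _) hin hS.hasSum
      _ ≤ (∑' M : ↥𝓜, ‖v M‖ ^ q) ^ (1 / q) * N := hH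
      _ ≤ ((t : ℝ) ^ q) ^ (1 / q) * N := by gcongr
      _ = t * N := by
          rw [← Real.rpow_mul t.coe_nonneg, mul_one_div_cancel hq0.ne', Real.rpow_one]
  refine le_of_forall_pos_le_add fun ε hε => ?_
  have hN1 : 0 < N + 1 := by linarith
  have hd : 0 < ε / (N + 1) := div_pos hε hN1
  have h := key (1 + (ε / (N + 1)).toNNReal) (by simpa using hd)
  refine h.trans ?_
  have : ε / (N + 1) * N ≤ ε := by
    rw [div_mul_eq_mul_div, div_le_iff₀ hN1]; nlinarith
  rw [NNReal.coe_add, NNReal.coe_one, Real.coe_toNNReal _ hd.le]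
  linarith

end Duality

theorem summable_norm_map_signed_sum_rpow {H : Type*} [NormedAddCommGroup H]
    [InnerProductSpace ℝ H] {𝓜 : Set (H →L[ℝ] H)} {p : ℝ} (hp : 1 ≤ p) {n : ℕ} {x : Fin n → H}
    (hsum : ∀ i, Summable fun M : ↥𝓜 => ‖(M : H →L[ℝ] H) (x i)‖ ^ p) (σ : Fin n → Bool) :
    Summable fun M : ↥𝓜 =>
      ‖(M : H →L[ℝ] H) (∑ i, (if σ i then (1 : ℝ) else -1) • x i)‖ ^ p := by
  refine .of_nonneg_of_le (fun M => by positivity) (fun M => ?_)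
    (Real.Lp_finset_sum_le_tsum_of_nonneg Finset.univ hp
      (f := fun i (M : ↥𝓜) => ‖(M : H →L[ℝ] H) (x i)‖) (fun i M => norm_nonneg _) hsum).1
  gcongr
  rw [map_sum]
  refine (norm_sum_le _ _).trans (Finset.sum_le_sum fun i _ => ?_)
  rw [map_smul, norm_smul]
  split_ifs <;> simp

theorem sum_tsum_norm_map_signed_sum_rpow_le {H : Type*} [NormedAddCommGroup H]
    [InnerProductSpace ℝ H] {𝓜 : Set (H →L[ℝ] H)} {p : ℝ} (hp : 2 ≤ p) {n : ℕ} {x : Fin n → H}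
    (hsum : ∀ i, Summable fun M : ↥𝓜 => ‖(M : H →L[ℝ] H) (x i)‖ ^ p) :
    ∑ σ : Fin n → Bool, ∑' M : ↥𝓜,
        ‖(M : H →L[ℝ] H) (∑ i, (if σ i then (1 : ℝ) else -1) • x i)‖ ^ p ≤
      2 ^ n * (p * ∑ i, ((∑' M : ↥𝓜, ‖(M : H →L[ℝ] H) (x i)‖ ^ p) ^ (1 / p)) ^ 2) ^ (p / 2) := by
  have hp0 : 0 < p := by linarith
  have hS := summable_norm_map_signed_sum_rpow (by linarith) hsum
  have hsq : ∀ u : ℝ, 0 ≤ u → (u ^ 2) ^ (p / 2) = u ^ p := fun u hu => by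
    rw [← Real.rpow_two, ← Real.rpow_mul hu]; congr 1; ring
  obtain ⟨hm, hmle⟩ := Real.Lp_finset_sum_le_tsum_of_nonneg Finset.univ (r := p / 2) (by linarith)
    (f := fun i (M : ↥𝓜) => ‖(M : H →L[ℝ] H) (x i)‖ ^ 2) (fun i M => by positivity)
    (fun i => by simpa only [hsq _ (norm_nonneg _)] using hsum i)
  simp only [hsq _ (norm_nonneg _)] at hmle
  have hR : ∀ i, ((∑' M : ↥𝓜, ‖(M : H →L[ℝ] H) (x i)‖ ^ p) ^ (1 / p)) ^ 2 =
      (∑' M : ↥𝓜, ‖(M : H →L[ℝ] H) (x i)‖ ^ p) ^ (1 / (p / 2)) := fun i => by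
    rw [← Real.rpow_two, ← Real.rpow_mul (by positivity)]; congr 1; field_simp
  simp only [hR]
  rw [← Summable.tsum_finsetSum fun σ _ => hS σ]
  calc _ ≤ ∑' M : ↥𝓜, 2 ^ n * p ^ (p / 2) * (∑ i, ‖(M : H →L[ℝ] H) (x i)‖ ^ 2) ^ (p / 2) := by
        refine Summable.tsum_le_tsum (fun M => ?_) (summable_sum fun σ _ => hS σ) (hm.mul_left _)
        have := sum_norm_signed_sum_rpow_le (fun i => (M : H →L[ℝ] H) (x i)) hp
        rw [Real.mul_rpow hp0.le (by positivity), ← mul_assoc] at this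
        simpa only [map_sum, map_smul] using this
    _ = 2 ^ n * p ^ (p / 2) * ∑' M : ↥𝓜, (∑ i, ‖(M : H →L[ℝ] H) (x i)‖ ^ 2) ^ (p / 2) :=
        tsum_mul_left
    _ ≤ _ := by
        rw [Real.mul_rpow hp0.le (by positivity), ← mul_assoc]
        gcongr
        rwa [← Real.rpow_inv_le_iff_of_pos (by positivity) (by positivity) (by positivity),
          ← one_div]

/-- Theorem 12 (the `ℓ_q` case): for conjugate exponents `1 < q ≤ 2` and `p`,
`𝓡_{𝓜_q}(x) ≤ (2^{3/2}/n) √(π p Σ_i ‖x_i‖²_{𝓜_q*})`, where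
`‖z‖_{𝓜_q*} = (Σ_{M ∈ 𝓜} ‖M z‖^p)^{1/p}`. -/
theorem rademacher_lq_bound
    {H : Type*} [NormedAddCommGroup H] [InnerProductSpace ℝ H] [CompleteSpace H]
    (𝓜 : Set (H →L[ℝ] H)) [Countable ↥𝓜]
    (hsym : ∀ M ∈ 𝓜, ∀ x y : H, ⟪M x, y⟫ = ⟪x, M y⟫)
    (hnondeg : ∀ x : H, x ≠ 0 → ∃ M ∈ 𝓜, M x ≠ 0)
    (C₀ : ℝ) (hbdd : ∀ M ∈ 𝓜, ‖M‖ ≤ C₀)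
    (q p : ℝ) (hq : 1 < q) (hq2 : q ≤ 2) (hpq : 1 / q + 1 / p = 1)
    {n : ℕ} (hn : 0 < n) (x : Fin n → H)
    (hsum : ∀ i, Summable fun M : ↥𝓜 => ‖(M : H →L[ℝ] H) (x i)‖ ^ p) :
    radCompQ 𝓜 q x ≤
      (2 ^ ((3 : ℝ) / 2) / n) *
        Real.sqrt (π * p * ∑ i,
          ((∑' M : ↥𝓜, ‖(M : H →L[ℝ] H) (x i)‖ ^ p) ^ (1 / p)) ^ 2) := by
  have hqp : q.HolderConjugate p := by
    rw [Real.holderConjugate_iff]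
    exact ⟨hq, by simpa using hpq⟩
  have hp0 : 0 < p := hqp.symm.pos
  have hp : 2 ≤ p := by
    have h1 : 1 / q ≥ 1 / 2 := one_div_le_one_div_of_le (by linarith) hq2
    exact (one_div_le_one_div hp0 two_pos).1 (by linarith)
  set D := ∑ i, ((∑' M : ↥𝓜, ‖(M : H →L[ℝ] H) (x i)‖ ^ p) ^ (1 / p)) ^ 2 with hD
  have hD0 : 0 ≤ D := by positivity
  set N : (Fin n → Bool) → ℝ := fun σ => ∑' M : ↥𝓜,
    ‖(M : H →L[ℝ] H) (∑ i, (if σ i then (1 : ℝ) else -1) • x i)‖ ^ p with hN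
  have hN0 : ∀ σ, 0 ≤ N σ := fun σ => by positivity
  have hsup : ∀ σ : Fin n → Bool, sSup {r : ℝ | ∃ β : H, MnormQ 𝓜 q β ≤ 1 ∧
      r = ∑ i, (if σ i then (1 : ℝ) else -1) * ⟪β, x i⟫} ≤ N σ ^ (1 / p) := by
    intro σ
    refine Real.sSup_le ?_ (by positivity [hN0 σ])
    rintro r ⟨β, hβ, rfl⟩
    have := inner_le_of_MnormQ_le_one hsym hqp hβ
      (summable_norm_map_signed_sum_rpow (by linarith) hsum σ)
    simpa only [inner_sum, real_inner_smul_right] using this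
  have hmean : (∑ σ, N σ ^ (1 / p)) / 2 ^ n ≤ √(p * D) := by
    have hJ := Real.arith_mean_le_rpow_mean Finset.univ (fun _ : Fin n → Bool => 1 / (2 : ℝ) ^ n)
      (fun σ => N σ ^ (1 / p)) (fun _ _ => by positivity) (by simp)
      (fun σ _ => Real.rpow_nonneg (hN0 σ) _) (p := p) (by linarith)
    have hpow : ∀ σ, (N σ ^ (1 / p)) ^ p = N σ := fun σ => by
      rw [← Real.rpow_mul (hN0 σ), one_div_mul_cancel hp0.ne', Real.rpow_one]
    simp only [hpow, ← Finset.mul_sum] at hJ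
    calc (∑ σ, N σ ^ (1 / p)) / 2 ^ n = 1 / 2 ^ n * ∑ σ, N σ ^ (1 / p) := by ring
      _ ≤ (1 / 2 ^ n * ∑ σ, N σ) ^ (1 / p) := hJ
      _ ≤ (1 / 2 ^ n * (2 ^ n * (p * D) ^ (p / 2))) ^ (1 / p) := by
          gcongr
          exact sum_tsum_norm_map_signed_sum_rpow_le hp hsum
      _ = √(p * D) := by
          rw [← mul_assoc, one_div_mul_cancel (by positivity), one_mul,
            ← Real.rpow_mul (by positivity), Real.sqrt_eq_rpow]
          congr 1; field_simp
  have h2 : (2 : ℝ) ≤ 2 ^ ((3 : ℝ) / 2) := by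
    conv_lhs => rw [← Real.rpow_one 2]
    exact Real.rpow_le_rpow_of_exponent_le (by norm_num) (by norm_num)
  calc radCompQ 𝓜 q x ≤ (2 / n) * ((∑ σ, N σ ^ (1 / p)) / 2 ^ n) := by
        unfold radCompQ
        gcongr with σ
        exact hsup σ
    _ ≤ (2 / n) * √(p * D) := by gcongr
    _ ≤ (2 ^ ((3 : ℝ) / 2) / n) * √(π * p * D) := by
        gcongr
        nlinarith [Real.pi_gt_three]
end
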